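/- arXiv:2209.02433 — 2 statements merged into one kernel-verified Lean document; each statement's English description precedes it below -/
import Mathlib

section
/- For i ∈ I define i^! ∈ I by s_{i^!} = w₀ s_i w₀; then i ↦ i^! is a well-defined involution of I. Moreover, for any semifield K: if (i_1,…,i_ν) ∈ ℐ then (i_1^!,…,i_ν^!) ∈ ℐ, and (i,a) ∼ (i',a') implies ((i_1^!,…,i_ν^!),a) ∼ ((i'_1{}^!,…,i'_ν{}^!),a'); hence the map i_1^{a_1}⋯i_ν^{a_ν} ↦ (i_1^!)^{a_1}⋯(i_ν^!)^{a_ν} induces a well-defined involution ι of 𝒰_K. -/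
open scoped BigOperators

namespace Lusztig

variable {I : Type*} [Fintype I] [DecidableEq I]

/-- A simply laced Cartan matrix: symmetric, positive definite, integer entries,
`2` on the diagonal and `0` or `-1` off the diagonal. -/
structure IsSimplyLacedCartan (A : Matrix I I ℤ) : Prop where
  symm : ∀ i j, A i j = A j i
  posDef : ∀ x : I → ℤ, x ≠ 0 → 0 < ∑ i, ∑ j, x i * A i j * x j
  diag : ∀ i, A i i = 2
  offDiag : ∀ i j, i ≠ j → A i j = 0 ∨ A i j = -1

/-- The simple reflection `s_i` acting on `ℤ[I] = I → ℤ`, `s_i(j') = j' - a_{ij} i'`. -/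
def sE (A : Matrix I I ℤ) (i : I) : Function.End (I → ℤ) :=
  fun x => x - (∑ j, A i j * x j) • Pi.single i 1

/-- The length of `w`: the least `n` such that `w` is a product of `n` simple
reflections (`∞` convention: `sInf ∅ = 0`). -/
noncomputable def len (A : Matrix I I ℤ) (w : Function.End (I → ℤ)) : ℕ :=
  sInf {n | ∃ l : List I, l.length = n ∧ (l.map (sE A)).prod = w}

/-- `w₀` is the longest element of `W = ⟨s_i⟩` and `ν = |w₀|`. -/
structure IsLongest (A : Matrix I I ℤ) (w₀ : Function.End (I → ℤ)) (ν : ℕ) : Prop where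
  mem : ∃ l : List I, (l.map (sE A)).prod = w₀
  len_eq : len A w₀ = ν
  longest : ∀ w : Function.End (I → ℤ),
    (∃ l : List I, (l.map (sE A)).prod = w) → len A w ≤ ν

/-- `ℐ`: the set of sequences `(i_1, …, i_ν)` with `s_{i_1} ⋯ s_{i_ν} = w₀`. -/
def RedWord (A : Matrix I I ℤ) (w₀ : Function.End (I → ℤ)) (ν : ℕ) :
    Set (Fin ν → I) :=
  {f | ((List.ofFn f).map (sE A)).prod = w₀}

/-- The coefficient `r_{h,k}` defined by
`s_{i_1} ⋯ s_{i_{k-1}} (i_k') = Σ_h r_{h,k} h'` (here `k` is `0`-indexed). -/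
def rCoef (A : Matrix I I ℤ) {ν : ℕ} (f : Fin ν → I) (h : I) (k : Fin ν) : ℤ :=
  ((List.ofFn fun m : Fin (k : ℕ) => sE A (f (Fin.castLE k.2.le m))).prod :
    Function.End (I → ℤ)) (Pi.single (f k) 1) h

/-- `‖i,a‖_h = Π_k a_k^{r_{h,k}}`. -/
def normAt (A : Matrix I I ℤ) {ν : ℕ} {K : Type*} [CommGroup K]
    (f : Fin ν → I) (a : Fin ν → K) (h : I) : K :=
  ∏ k : Fin ν, a k ^ rCoef A f h k

section Semifield

variable {K : Type*} [CommGroup K] [AddCommSemigroup K]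

/-- Adjacency of two pairs in `ℐ × K^ν`, for a semifield `K` (written
multiplicatively, with addition `+`). -/
def Adjacent (A : Matrix I I ℤ) (w₀ : Function.End (I → ℤ)) (ν : ℕ)
    (p q : (Fin ν → I) × (Fin ν → K)) : Prop :=
  p.1 ∈ RedWord A w₀ ν ∧ q.1 ∈ RedWord A w₀ ν ∧
  ((∃ (l : ℕ) (h0 : l < ν) (h1 : l + 1 < ν) (h2 : l + 2 < ν),
      A (p.1 ⟨l, h0⟩) (p.1 ⟨l + 1, h1⟩) = -1 ∧
      p.1 ⟨l + 2, h2⟩ = p.1 ⟨l, h0⟩ ∧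
      q.1 ⟨l, h0⟩ = p.1 ⟨l + 1, h1⟩ ∧ q.1 ⟨l + 1, h1⟩ = p.1 ⟨l, h0⟩ ∧
      q.1 ⟨l + 2, h2⟩ = p.1 ⟨l + 1, h1⟩ ∧
      (∀ k : Fin ν, (k : ℕ) ≠ l → (k : ℕ) ≠ l + 1 → (k : ℕ) ≠ l + 2 →
        q.1 k = p.1 k ∧ q.2 k = p.2 k) ∧
      q.2 ⟨l, h0⟩ =
        p.2 ⟨l + 1, h1⟩ * p.2 ⟨l + 2, h2⟩ * (p.2 ⟨l, h0⟩ + p.2 ⟨l + 2, h2⟩)⁻¹ ∧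
      q.2 ⟨l + 1, h1⟩ = p.2 ⟨l, h0⟩ + p.2 ⟨l + 2, h2⟩ ∧
      q.2 ⟨l + 2, h2⟩ =
        p.2 ⟨l, h0⟩ * p.2 ⟨l + 1, h1⟩ * (p.2 ⟨l, h0⟩ + p.2 ⟨l + 2, h2⟩)⁻¹) ∨
   (∃ (l : ℕ) (h0 : l < ν) (h1 : l + 1 < ν),
      A (p.1 ⟨l, h0⟩) (p.1 ⟨l + 1, h1⟩) = 0 ∧
      q.1 ⟨l, h0⟩ = p.1 ⟨l + 1, h1⟩ ∧ q.1 ⟨l + 1, h1⟩ = p.1 ⟨l, h0⟩ ∧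
      (∀ k : Fin ν, (k : ℕ) ≠ l → (k : ℕ) ≠ l + 1 →
        q.1 k = p.1 k ∧ q.2 k = p.2 k) ∧
      q.2 ⟨l, h0⟩ = p.2 ⟨l + 1, h1⟩ ∧ q.2 ⟨l + 1, h1⟩ = p.2 ⟨l, h0⟩))

end Semifield

/-- Adjacency of two pairs in `ℐ × ℤ^ν` for the tropical semifield `ℤ`
(sum = `min`, product = `+`). -/
def TAdjacent (A : Matrix I I ℤ) (w₀ : Function.End (I → ℤ)) (ν : ℕ)
    (p q : (Fin ν → I) × (Fin ν → ℤ)) : Prop :=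
  p.1 ∈ RedWord A w₀ ν ∧ q.1 ∈ RedWord A w₀ ν ∧
  ((∃ (l : ℕ) (h0 : l < ν) (h1 : l + 1 < ν) (h2 : l + 2 < ν),
      A (p.1 ⟨l, h0⟩) (p.1 ⟨l + 1, h1⟩) = -1 ∧
      p.1 ⟨l + 2, h2⟩ = p.1 ⟨l, h0⟩ ∧
      q.1 ⟨l, h0⟩ = p.1 ⟨l + 1, h1⟩ ∧ q.1 ⟨l + 1, h1⟩ = p.1 ⟨l, h0⟩ ∧
      q.1 ⟨l + 2, h2⟩ = p.1 ⟨l + 1, h1⟩ ∧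
      (∀ k : Fin ν, (k : ℕ) ≠ l → (k : ℕ) ≠ l + 1 → (k : ℕ) ≠ l + 2 →
        q.1 k = p.1 k ∧ q.2 k = p.2 k) ∧
      q.2 ⟨l, h0⟩ =
        p.2 ⟨l + 1, h1⟩ + p.2 ⟨l + 2, h2⟩ - min (p.2 ⟨l, h0⟩) (p.2 ⟨l + 2, h2⟩) ∧
      q.2 ⟨l + 1, h1⟩ = min (p.2 ⟨l, h0⟩) (p.2 ⟨l + 2, h2⟩) ∧
      q.2 ⟨l + 2, h2⟩ =
        p.2 ⟨l, h0⟩ + p.2 ⟨l + 1, h1⟩ - min (p.2 ⟨l, h0⟩) (p.2 ⟨l + 2, h2⟩)) ∨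
   (∃ (l : ℕ) (h0 : l < ν) (h1 : l + 1 < ν),
      A (p.1 ⟨l, h0⟩) (p.1 ⟨l + 1, h1⟩) = 0 ∧
      q.1 ⟨l, h0⟩ = p.1 ⟨l + 1, h1⟩ ∧ q.1 ⟨l + 1, h1⟩ = p.1 ⟨l, h0⟩ ∧
      (∀ k : Fin ν, (k : ℕ) ≠ l → (k : ℕ) ≠ l + 1 →
        q.1 k = p.1 k ∧ q.2 k = p.2 k) ∧
      q.2 ⟨l, h0⟩ = p.2 ⟨l + 1, h1⟩ ∧ q.2 ⟨l + 1, h1⟩ = p.2 ⟨l, h0⟩))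

open Matrix

/-- Membership in the Weyl group: `w` is a product of simple reflections. -/
def InWeyl (A : Matrix I I ℤ) (w : Function.End (I → ℤ)) : Prop :=
  ∃ l : List I, (l.map (sE A)).prod = w

theorem sE_apply (A : Matrix I I ℤ) (i : I) (x : I → ℤ) :
    sE A i x = x - (A *ᵥ x) i • Pi.single i 1 := rfl

theorem sE_single (A : Matrix I I ℤ) (i j : I) :
    sE A i (Pi.single j 1) = Pi.single j 1 - A i j • Pi.single i 1 := by
  simp [sE_apply]

namespace InWeyl

variable {A : Matrix I I ℤ}

theorem sE (i : I) : InWeyl A (sE A i) := ⟨[i], by simp⟩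

theorem mul {v w : Function.End (I → ℤ)} (hv : InWeyl A v) (hw : InWeyl A w) :
    InWeyl A (v * w) := by
  obtain ⟨l, rfl⟩ := hv
  obtain ⟨m, rfl⟩ := hw
  exact ⟨l ++ m, by simp⟩

theorem induction_on {P : Function.End (I → ℤ) → Prop} {w : Function.End (I → ℤ)}
    (hw : InWeyl A w) (h1 : P 1) (hs : ∀ i v, P v → P (Lusztig.sE A i * v)) : P w := by
  obtain ⟨l, rfl⟩ := hw
  induction l with
  | nil => exact h1
  | cons i l ih => simpa using hs i _ ih

theorem exists_linearMap {w : Function.End (I → ℤ)} (hw : InWeyl A w) :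
    ∃ φ : (I → ℤ) →ₗ[ℤ] (I → ℤ), ∀ x, w x = φ x := by
  refine hw.induction_on
    (P := fun w => ∃ φ : (I → ℤ) →ₗ[ℤ] (I → ℤ), ∀ x, w x = φ x) ⟨LinearMap.id, fun _ => rfl⟩ ?_
  rintro i v ⟨φ, hφ⟩
  refine ⟨φ - ((LinearMap.proj i).comp (A.mulVecLin.comp φ)).smulRight (Pi.single i 1), ?_⟩
  intro x
  change Lusztig.sE A i (v x) = _
  simp [sE_apply, hφ]

theorem map_sub {w : Function.End (I → ℤ)} (hw : InWeyl A w) (x y : I → ℤ) :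
    w (x - y) = w x - w y := by
  obtain ⟨φ, hφ⟩ := hw.exists_linearMap
  simp [hφ]

theorem map_add {w : Function.End (I → ℤ)} (hw : InWeyl A w) (x y : I → ℤ) :
    w (x + y) = w x + w y := by
  obtain ⟨φ, hφ⟩ := hw.exists_linearMap
  simp [hφ]

theorem map_smul {w : Function.End (I → ℤ)} (hw : InWeyl A w) (c : ℤ) (x : I → ℤ) :
    w (c • x) = c • w x := by
  obtain ⟨φ, hφ⟩ := hw.exists_linearMap
  simp only [hφ, _root_.map_smul]

theorem map_neg {w : Function.End (I → ℤ)} (hw : InWeyl A w) (x : I → ℤ) :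
    w (-x) = -w x := by
  obtain ⟨φ, hφ⟩ := hw.exists_linearMap
  simp [hφ]

theorem map_zero {w : Function.End (I → ℤ)} (hw : InWeyl A w) : w 0 = 0 := by
  obtain ⟨φ, hφ⟩ := hw.exists_linearMap
  simp [hφ]

theorem apply_eq_sum {w : Function.End (I → ℤ)} (hw : InWeyl A w) (x : I → ℤ) :
    w x = ∑ i, x i • w (Pi.single i 1) := by
  obtain ⟨φ, hφ⟩ := hw.exists_linearMap
  simp only [hφ, ← _root_.map_smul, ← map_sum]
  congr 1
  funext j
  simp [Finset.sum_apply, Pi.single_apply]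

theorem exists_len {w : Function.End (I → ℤ)} (hw : InWeyl A w) :
    ∃ l : List I, l.length = len A w ∧ (l.map (Lusztig.sE A)).prod = w := by
  obtain ⟨l, hl⟩ := hw
  exact Nat.sInf_mem (s := {n | ∃ l : List I, l.length = n ∧ (l.map (Lusztig.sE A)).prod = w})
    ⟨_, l, rfl, hl⟩

theorem len_mul_sE_le {w : Function.End (I → ℤ)} (hw : InWeyl A w) (i : I) :
    len A (w * Lusztig.sE A i) ≤ len A w + 1 := by
  obtain ⟨l, hl, h⟩ := hw.exists_len
  exact Nat.sInf_le ⟨l ++ [i], by simp [hl], by simp [h]⟩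

theorem eq_one_or_exists_descent {w : Function.End (I → ℤ)} (hw : InWeyl A w) :
    w = 1 ∨ ∃ u j, InWeyl A u ∧ w = u * Lusztig.sE A j ∧ len A u < len A w := by
  obtain ⟨l, hl, rfl⟩ := hw.exists_len
  rcases l.eq_nil_or_concat with rfl | ⟨m, j, rfl⟩
  · exact Or.inl rfl
  · refine Or.inr ⟨(m.map (Lusztig.sE A)).prod, j, ⟨m, rfl⟩, by simp, ?_⟩
    rw [← hl]
    have : len A (m.map (Lusztig.sE A)).prod ≤ m.length := Nat.sInf_le ⟨m, rfl, rfl⟩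
    simp
    omega

end InWeyl

namespace IsSimplyLacedCartan

variable {A : Matrix I I ℤ} (hA : IsSimplyLacedCartan A)
include hA

theorem sE_mul_self (i : I) : sE A i * sE A i = 1 := by
  funext x
  change sE A i (sE A i x) = x
  simp only [sE_apply, mulVec_sub, mulVec_smul, mulVec_single_one, Pi.sub_apply, Pi.smul_apply,
    col_apply, hA.diag, smul_eq_mul]
  module

theorem sE_comm {i j : I} (h : A i j = 0) : sE A i * sE A j = sE A j * sE A i := by
  have h' : A j i = 0 := by rw [hA.symm, h]
  funext x
  change sE A i (sE A j x) = sE A j (sE A i x)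
  simp only [sE_apply, mulVec_sub, mulVec_smul, mulVec_single_one, Pi.sub_apply, Pi.smul_apply,
    col_apply, h, h', smul_eq_mul]
  module

theorem sE_braid {i j : I} (h : A i j = -1) :
    sE A i * sE A j * sE A i = sE A j * sE A i * sE A j := by
  have h' : A j i = -1 := by rw [hA.symm, h]
  funext x
  change sE A i (sE A j (sE A i x)) = sE A j (sE A i (sE A j x))
  simp only [sE_apply, mulVec_sub, mulVec_smul, mulVec_single_one, Pi.sub_apply, Pi.smul_apply,
    col_apply, h, h', hA.diag, smul_eq_mul]
  module

theorem sE_single_self (i : I) : sE A i (Pi.single i 1) = -Pi.single i 1 := by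
  rw [sE_single, hA.diag]
  module

theorem sE_injective : Function.Injective (sE A) := by
  intro i j h
  by_contra hij
  have := congrFun (congrFun h (Pi.single i 1)) i
  rw [hA.sE_single_self, sE_single] at this
  simp [hij] at this

/-- If `w sᵢ` is not shorter than `w`, then `w` sends the simple root `i'` to a positive root. -/
theorem apply_single_nonneg {w : Function.End (I → ℤ)} (hw : InWeyl A w) (i : I)
    (h : len A w ≤ len A (w * sE A i)) : 0 ≤ w (Pi.single i 1) := by
  induction hn : len A w using Nat.strong_induction_on generalizing w i with
  | _ n ih =>
  subst hn
  rcases hw.eq_one_or_exists_descent with rfl | ⟨u, j, hu, rfl, hlt⟩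
  · change (0 : I → ℤ) ≤ Pi.single i 1
    simp
  have hlen := hu.len_mul_sE_le j
  have hij : i ≠ j := by
    rintro rfl
    rw [mul_assoc, hA.sE_mul_self, mul_one] at h
    omega
  change 0 ≤ u (sE A j (Pi.single i 1))
  rw [sE_single]
  rcases hA.offDiag i j hij with h0 | h1
  · rw [hA.symm j i, h0, zero_smul, sub_zero]
    refine ih _ hlt hu i ?_ rfl
    by_contra! hc
    rw [mul_assoc, ← hA.sE_comm h0, ← mul_assoc] at h
    have := (hu.mul (.sE i)).len_mul_sE_le j
    omega
  · rw [hA.symm j i, h1]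
    have huj : 0 ≤ u (Pi.single j 1) := ih _ hlt hu j hlt.le rfl
    by_cases hc : len A u ≤ len A (u * sE A i)
    · have hui : 0 ≤ u (Pi.single i 1) := ih _ hlt hu i hc rfl
      rw [neg_one_smul, sub_neg_eq_add, hu.map_add]
      exact add_nonneg hui huj
    · push Not at hc
      obtain ⟨x, hx⟩ : ∃ x, x = u * sE A i := ⟨_, rfl⟩
      have hxW : InWeyl A x := hx ▸ hu.mul (.sE i)
      have hux : u = x * sE A i := by rw [hx, mul_assoc, hA.sE_mul_self, mul_one]
      rw [← hx] at hc
      subst hux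
      change 0 ≤ x (sE A i _)
      have hroot : sE A i (Pi.single i 1 - (-1 : ℤ) • Pi.single j 1) = Pi.single j 1 := by
        rw [(InWeyl.sE i).map_sub, (InWeyl.sE i).map_smul, hA.sE_single_self, sE_single, h1]
        module
      rw [hroot]
      refine ih _ (hc.trans hlt) hxW j ?_ rfl
      by_contra! hd
      have e : x * sE A i * sE A j * sE A i = x * sE A j * sE A i * sE A j := by
        simpa only [mul_assoc] using congrArg (x * ·) (hA.sE_braid h1)
      rw [e] at h
      have h2 := (hxW.mul (.sE j)).len_mul_sE_le i
      have h3 := ((hxW.mul (.sE j)).mul (.sE i)).len_mul_sE_le j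
      omega

theorem injective {w : Function.End (I → ℤ)} (hw : InWeyl A w) : Function.Injective w := by
  refine hw.induction_on (P := fun w => Function.Injective w) Function.injective_id ?_
  intro i v hv
  have hs : Function.LeftInverse (sE A i) (sE A i) := fun x => congrFun (hA.sE_mul_self i) x
  exact hs.injective.comp hv

theorem eq_one_of_nonneg {w : Function.End (I → ℤ)} (hw : InWeyl A w)
    (h : ∀ i, 0 ≤ w (Pi.single i 1)) : w = 1 := by
  rcases hw.eq_one_or_exists_descent with h1 | ⟨u, j, hu, rfl, hlt⟩
  · exact h1
  have hpos := hA.apply_single_nonneg hu j hlt.le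
  have hneg : 0 ≤ u (sE A j (Pi.single j 1)) := h j
  rw [hA.sE_single_self, hu.map_neg] at hneg
  have h0 : u (Pi.single j 1) = u 0 := by
    rw [hu.map_zero]
    exact le_antisymm (neg_nonneg.mp hneg) hpos
  have := congrFun (hA.injective hu h0) j
  simp at this

theorem form_invariant {w : Function.End (I → ℤ)} (hw : InWeyl A w) (x y : I → ℤ) :
    w x ⬝ᵥ A *ᵥ w y = x ⬝ᵥ A *ᵥ y := by
  refine hw.induction_on (P := fun w => w x ⬝ᵥ A *ᵥ w y = x ⬝ᵥ A *ᵥ y) rfl ?_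
  intro i v hv
  change sE A i (v x) ⬝ᵥ A *ᵥ sE A i (v y) = _
  have hT : Aᵀ = A := by
    ext i j
    exact hA.symm j i
  have hcol (z : I → ℤ) : z ⬝ᵥ A.col i = (A *ᵥ z) i := by
    rw [dotProduct_comm]
    conv_rhs => rw [← hT]
    rfl
  rw [← hv]
  simp only [sE_apply, mulVec_sub, mulVec_smul, mulVec_single_one, dotProduct_sub,
    sub_dotProduct, smul_dotProduct, dotProduct_smul, single_one_dotProduct, hcol,
    Pi.sub_apply, Pi.smul_apply, col_apply, hA.diag, smul_eq_mul]
  ring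

section Longest

variable {w₀ : Function.End (I → ℤ)} {ν : ℕ} (hw : IsLongest A w₀ ν)
include hw

theorem longest_apply_single_nonpos (i : I) : w₀ (Pi.single i 1) ≤ 0 := by
  have hW : InWeyl A w₀ := hw.mem
  have hWi := hW.mul (.sE i)
  have := hA.apply_single_nonneg hWi i (by
    rw [mul_assoc, hA.sE_mul_self, mul_one, hw.len_eq]
    exact hw.longest _ hWi)
  change 0 ≤ w₀ (sE A i (Pi.single i 1)) at this
  rw [hA.sE_single_self, hW.map_neg] at this
  exact neg_nonneg.mp this

theorem longest_mul_self : w₀ * w₀ = 1 := by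
  have hW : InWeyl A w₀ := hw.mem
  refine hA.eq_one_of_nonneg (hW.mul hW) fun i => ?_
  change 0 ≤ w₀ (w₀ (Pi.single i 1))
  rw [hW.apply_eq_sum]
  refine Finset.sum_nonneg fun j _ => ?_
  exact smul_nonneg_of_nonpos_of_nonpos (hA.longest_apply_single_nonpos hw i j)
    (hA.longest_apply_single_nonpos hw j)

theorem longest_longest_apply (x : I → ℤ) : w₀ (w₀ x) = x :=
  congrFun (hA.longest_mul_self hw) x

/-- The longest element maps every simple root to the negative of a simple root. -/
theorem exists_longest_apply_single (i : I) :
    ∃ k, w₀ (Pi.single i 1) = -Pi.single k 1 := by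
  have hW : InWeyl A w₀ := hw.mem
  set M : I → I → ℤ := fun a b => -w₀ (Pi.single b 1) a with hM
  have hM0 (a b : I) : 0 ≤ M a b := neg_nonneg.mpr (hA.longest_apply_single_nonpos hw b a)
  have hMM (a b : I) : ∑ k, M k b * M a k = (Pi.single b 1 : I → ℤ) a := by
    conv_rhs => rw [← hA.longest_longest_apply hw (Pi.single b 1), hW.apply_eq_sum]
    simp [hM]
  obtain ⟨k, -, hk⟩ : ∃ k ∈ Finset.univ, M k i * M i k ≠ 0 :=
    Finset.exists_ne_zero_of_sum_ne_zero (by rw [hMM]; simp)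
  have hki : 0 < M k i := (hM0 k i).lt_of_ne' (left_ne_zero_of_mul hk)
  have hik : 0 < M i k := (hM0 i k).lt_of_ne' (right_ne_zero_of_mul hk)
  have hle : M k i * M i k ≤ 1 := by
    calc M k i * M i k ≤ ∑ k, M k i * M i k :=
          Finset.single_le_sum (f := fun k => M k i * M i k)
            (fun k _ => mul_nonneg (hM0 k i) (hM0 i k)) (Finset.mem_univ k)
      _ = 1 := by rw [hMM]; simp
  have h1 : M i k = 1 := by nlinarith
  have hcol : w₀ (Pi.single k 1) = -Pi.single i 1 := by
    funext a
    have ha : M a k = (Pi.single i 1 : I → ℤ) a := by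
      by_cases hai : a = i
      · subst hai
        simpa using h1
      · have h0 : ∑ c, M c i * M a c = 0 := by rw [hMM]; simp [hai]
        rw [Finset.sum_eq_zero_iff_of_nonneg
          fun c _ => mul_nonneg (hM0 c i) (hM0 a c)] at h0
        have := (mul_eq_zero.mp (h0 k (Finset.mem_univ k))).resolve_left hki.ne'
        simpa [hai] using this
    rw [Pi.neg_apply, ← ha, hM, neg_neg]
  refine ⟨k, ?_⟩
  rw [← hA.longest_longest_apply hw (Pi.single k 1), hcol, hW.map_neg, neg_neg]

theorem longest_conj_sE {i k : I} (h : w₀ (Pi.single i 1) = -Pi.single k 1) :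
    sE A k = w₀ * sE A i * w₀ := by
  have hW : InWeyl A w₀ := hw.mem
  funext x
  change _ = w₀ (sE A i (w₀ x))
  have hcoef : (A *ᵥ w₀ x) i = -(A *ᵥ x) k := by
    have := hA.form_invariant hW (w₀ (Pi.single i 1)) x
    rwa [hA.longest_longest_apply hw, h, single_one_dotProduct, neg_dotProduct,
      single_one_dotProduct] at this
  rw [sE_apply, sE_apply, hW.map_sub, hW.map_smul, hA.longest_longest_apply hw, h, hcoef]
  module

theorem longest_apply_single_of_conj {i k : I} (h : sE A k = w₀ * sE A i * w₀) :
    w₀ (Pi.single i 1) = -Pi.single k 1 := by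
  obtain ⟨j, hj⟩ := hA.exists_longest_apply_single hw i
  rw [hj, hA.sE_injective (h.trans (hA.longest_conj_sE hw hj).symm)]

theorem conj_prod {excl : I → I} (hexcl : ∀ i, sE A (excl i) = w₀ * sE A i * w₀) (l : List I) :
    ((l.map excl).map (sE A)).prod = w₀ * (l.map (sE A)).prod * w₀ := by
  have h := hA.longest_mul_self hw
  induction l with
  | nil => simp [h]
  | cons i l ih =>
    simp only [List.map_cons, List.prod_cons, ih, hexcl]
    calc w₀ * sE A i * w₀ * (w₀ * (l.map (sE A)).prod * w₀)
        = w₀ * sE A i * (w₀ * w₀) * (l.map (sE A)).prod * w₀ := by simp only [mul_assoc]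
      _ = _ := by rw [h]; simp only [mul_assoc, mul_one]

theorem comp_mem_redWord {excl : I → I} (hexcl : ∀ i, sE A (excl i) = w₀ * sE A i * w₀)
    {f : Fin ν → I} (hf : f ∈ RedWord A w₀ ν) : excl ∘ f ∈ RedWord A w₀ ν := by
  change ((List.ofFn f).map (sE A)).prod = w₀ at hf
  change ((List.ofFn (excl ∘ f)).map (sE A)).prod = w₀
  rw [← List.map_ofFn, hA.conj_prod hw hexcl, hf, hA.longest_mul_self hw, one_mul]

theorem cartan_excl {excl : I → I} (hexcl : ∀ i, sE A (excl i) = w₀ * sE A i * w₀) (i j : I) :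
    A (excl i) (excl j) = A i j := by
  have := hA.form_invariant hw.mem (Pi.single i 1) (Pi.single j 1)
  rw [hA.longest_apply_single_of_conj hw (hexcl i),
    hA.longest_apply_single_of_conj hw (hexcl j)] at this
  simpa [mulVec_neg] using this

end Longest

end IsSimplyLacedCartan

/-- `i ↦ i^!` defined by `s_{i^!} = w₀ s_i w₀` is a well-defined
involution of `I`; it sends reduced words for `w₀` to reduced words, preserves
`∼`, and hence induces an involution `ι` of `𝒰_K`. -/
theorem excl_involution (A : Matrix I I ℤ) (hA : IsSimplyLacedCartan A)
    (w₀ : Function.End (I → ℤ)) (ν : ℕ) (hw : IsLongest A w₀ ν)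
    {K : Type*} [CommGroup K] [AddCommSemigroup K]
    (hdist : ∀ a b c : K, a * (b + c) = a * b + a * c) :
    (∀ i : I, ∃! j : I, sE A j = w₀ * sE A i * w₀) ∧
    (∀ excl : I → I, (∀ i : I, sE A (excl i) = w₀ * sE A i * w₀) →
      (∀ i : I, excl (excl i) = i) ∧
      (∀ f : Fin ν → I, f ∈ RedWord A w₀ ν → (excl ∘ f) ∈ RedWord A w₀ ν) ∧
      (∀ p q : (Fin ν → I) × (Fin ν → K),
        Relation.EqvGen (Adjacent A w₀ ν) p q →
        Relation.EqvGen (Adjacent A w₀ ν)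
          (excl ∘ p.1, p.2) (excl ∘ q.1, q.2))) := by
  refine ⟨fun i => ?_, fun excl hexcl => ⟨fun i => ?_,
    fun f hf => hA.comp_mem_redWord hw hexcl hf, fun p q hpq => ?_⟩⟩
  · obtain ⟨k, hk⟩ := hA.exists_longest_apply_single hw i
    have hconj := hA.longest_conj_sE hw hk
    exact ⟨k, hconj, fun j hj => hA.sE_injective (hj.trans hconj.symm)⟩
  · have h := hA.longest_mul_self hw
    apply hA.sE_injective
    calc sE A (excl (excl i)) = (w₀ * w₀) * sE A i * (w₀ * w₀) := by
          rw [hexcl, hexcl]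
          simp only [mul_assoc]
      _ = sE A i := by rw [h, one_mul, mul_one]
  · have hC := hA.cartan_excl hw hexcl
    induction hpq with
    | refl => exact .refl _
    | symm _ _ _ ih => exact .symm _ _ ih
    | trans _ _ _ _ _ ih ih' => exact .trans _ _ _ ih ih'
    | rel p q hpq =>
      obtain ⟨hp, hq, h⟩ := hpq
      refine .rel _ _ ⟨hA.comp_mem_redWord hw hexcl hp, hA.comp_mem_redWord hw hexcl hq, ?_⟩
      rcases h with ⟨l, h0, h1, h2, ha, e1, e2, e3, e4, hk, hrest⟩ |
        ⟨l, h0, h1, ha, e1, e2, hk, hrest⟩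
      · refine Or.inl ⟨l, h0, h1, h2, (hC _ _).trans ha, congrArg excl e1, congrArg excl e2,
          congrArg excl e3, congrArg excl e4, fun k k0 k1 k2 => ?_, hrest⟩
        exact ⟨congrArg excl (hk k k0 k1 k2).1, (hk k k0 k1 k2).2⟩
      · refine Or.inr ⟨l, h0, h1, (hC _ _).trans ha, congrArg excl e1, congrArg excl e2,
          fun k k0 k1 => ?_, hrest⟩
        exact ⟨congrArg excl (hk k k0 k1).1, (hk k k0 k1).2⟩

end Lusztig
end

section
/- Let K = ℤ be the tropical semifield and let p = (p_i)_{i∈I} ∈ ℕ^I. For any two i, i' ∈ ℐ, the pairs (i,(p_{i_1},p_{i_2},…,p_{i_ν})) and (i',(p_{i'_1},p_{i'_2},…,p_{i'_ν})) are equivalent under ∼. Hence there is a well-defined element h_p ∈ 𝒰_ℕ, the common equivalence class of these pairs. -/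
open scoped BigOperators

namespace Lusztig

variable {I : Type*} [Fintype I] [DecidableEq I]

section Matsumoto

set_option linter.unusedSectionVars false

open Matrix

variable {A : Matrix I I ℤ}

/-- The bilinear form on `ℤ[I]` attached to a Cartan matrix. -/
def cartanForm (A : Matrix I I ℤ) (x y : I → ℤ) : ℤ := x ⬝ᵥ A *ᵥ y

/-- The simple reflection as a linear endomorphism of `ℤ[I]`. -/
def simpleRefl (A : Matrix I I ℤ) (i : I) : Module.End ℤ (I → ℤ) where
  toFun x := x - (A *ᵥ x) i • Pi.single i 1
  map_add' x y := by
    simp only [mulVec_add, Pi.add_apply, add_smul]; abel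
  map_smul' c x := by
    simp only [mulVec_smul, Pi.smul_apply, smul_sub, smul_smul, smul_eq_mul, RingHom.id_apply]

/-- The element of the Weyl group represented by a word. -/
def wordEnd (A : Matrix I I ℤ) (l : List I) : Module.End ℤ (I → ℤ) :=
  (l.map (simpleRefl A)).prod

lemma simpleRefl_apply (i : I) (x : I → ℤ) :
    simpleRefl A i x = x - (A *ᵥ x) i • Pi.single i 1 := rfl

lemma simpleRefl_apply_of_ne {i j : I} (h : j ≠ i) (x : I → ℤ) :
    simpleRefl A i x j = x j := by
  simp [simpleRefl_apply, h]

@[simp] lemma wordEnd_nil : wordEnd A [] = 1 := rfl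

@[simp] lemma wordEnd_cons (i : I) (l : List I) :
    wordEnd A (i :: l) = simpleRefl A i * wordEnd A l := by simp [wordEnd]

@[simp] lemma wordEnd_append (l m : List I) :
    wordEnd A (l ++ m) = wordEnd A l * wordEnd A m := by simp [wordEnd]

lemma prod_sE_apply (l : List I) (x : I → ℤ) :
    (l.map (sE A)).prod x = wordEnd A l x := by
  induction l with
  | nil => rfl
  | cons i l ih =>
    rw [List.map_cons, List.prod_cons, wordEnd_cons, Module.End.mul_apply, ← ih]
    rfl

lemma prod_sE_eq_iff (l m : List I) :
    (l.map (sE A)).prod = (m.map (sE A)).prod ↔ wordEnd A l = wordEnd A m := by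
  constructor
  · intro h
    refine LinearMap.ext fun x => ?_
    rw [← prod_sE_apply, ← prod_sE_apply, h]
  · intro h
    funext x
    rw [prod_sE_apply, prod_sE_apply, h]

/-- The root system: vectors of norm two. -/
def IsRoot (A : Matrix I I ℤ) (x : I → ℤ) : Prop := cartanForm A x x = 2

lemma cartanForm_add (x y z : I → ℤ) :
    cartanForm A (x + y) z = cartanForm A x z + cartanForm A y z := by
  simp [cartanForm, add_dotProduct]

lemma cartanForm_smul (c : ℤ) (x y : I → ℤ) :
    cartanForm A (c • x) y = c * cartanForm A x y :=
  smul_dotProduct c x _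

lemma cartanForm_single (i : I) (y : I → ℤ) :
    cartanForm A (Pi.single i 1) y = (A *ᵥ y) i := by
  simp [cartanForm]

lemma mulVec_single_apply (i j : I) : (A *ᵥ Pi.single j 1) i = A i j := by
  simp

lemma simpleRefl_single (i j : I) :
    simpleRefl A i (Pi.single j 1) = Pi.single j 1 - A i j • Pi.single i 1 := by
  rw [simpleRefl_apply, mulVec_single_apply]

lemma cartanForm_eq_sum (x y : I → ℤ) :
    cartanForm A x y = ∑ i, ∑ j, x i * A i j * y j := by
  simp [cartanForm, dotProduct, mulVec, Finset.mul_sum, mul_assoc]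

namespace IsSimplyLacedCartan

lemma cartanForm_comm (hA : IsSimplyLacedCartan A)
    (x y : I → ℤ) : cartanForm A x y = cartanForm A y x := by
  rw [cartanForm_eq_sum, cartanForm_eq_sum, Finset.sum_comm]
  refine Finset.sum_congr rfl fun i _ => Finset.sum_congr rfl fun j _ => ?_
  rw [hA.symm]; ring

lemma cartanForm_add_self (hA : IsSimplyLacedCartan A) (x y : I → ℤ) :
    cartanForm A (x + y) (x + y)
      = cartanForm A x x + cartanForm A y y + 2 * cartanForm A x y := by
  rw [cartanForm_add, hA.cartanForm_comm x, hA.cartanForm_comm y, cartanForm_add, cartanForm_add,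
    hA.cartanForm_comm y x]
  ring

lemma cartanForm_smul_single_self (hA : IsSimplyLacedCartan A) (c : ℤ) (i : I) :
    cartanForm A (c • Pi.single i 1) (c • Pi.single i 1) = 2 * c ^ 2 := by
  rw [cartanForm_smul, hA.cartanForm_comm, cartanForm_smul, cartanForm_single,
    mulVec_single_apply, hA.diag]
  ring

lemma even_cartanForm_self (hA : IsSimplyLacedCartan A) (x : I → ℤ) : Even (cartanForm A x x) := by
  rw [← Finset.univ_sum_single x]
  refine Finset.sum_induction _ (fun y => Even (cartanForm A y y)) ?_ ?_ ?_
  · intro y z hy hz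
    rw [hA.cartanForm_add_self]
    exact (hy.add hz).add (even_two_mul _)
  · simp [cartanForm]
  · intro i _
    have : (Pi.single i (x i) : I → ℤ) = x i • Pi.single i 1 := by
      simp [← Pi.single_smul]
    rw [this, hA.cartanForm_smul_single_self]
    exact even_two_mul _

lemma two_le_cartanForm_self (hA : IsSimplyLacedCartan A)
    {x : I → ℤ} (hx : x ≠ 0) : 2 ≤ cartanForm A x x := by
  have h := hA.posDef x hx
  rw [← cartanForm_eq_sum] at h
  obtain ⟨k, hk⟩ := hA.even_cartanForm_self x
  omega

lemma isRoot_single (hA : IsSimplyLacedCartan A) (i : I) : IsRoot A (Pi.single i 1) := by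
  rw [IsRoot, cartanForm_single, mulVec_single_apply, hA.diag]

lemma isRoot_simpleRefl (hA : IsSimplyLacedCartan A) {x : I → ℤ} (hx : IsRoot A x) (i : I) :
    IsRoot A (simpleRefl A i x) := by
  rw [IsRoot] at *
  rw [simpleRefl_apply, sub_eq_add_neg, ← neg_smul, hA.cartanForm_add_self,
    hA.cartanForm_smul_single_self, hA.cartanForm_comm x (_ • _), cartanForm_smul,
    cartanForm_single, hx]
  ring

lemma isRoot_wordEnd (hA : IsSimplyLacedCartan A) {x : I → ℤ} (hx : IsRoot A x) (l : List I) :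
    IsRoot A (wordEnd A l x) := by
  induction l with
  | nil => exact hx
  | cons i l ih =>
    rw [wordEnd_cons, Module.End.mul_apply]
    exact hA.isRoot_simpleRefl ih i

lemma nonneg_or_nonpos (hA : IsSimplyLacedCartan A)
    {x : I → ℤ} (hx : IsRoot A x) : 0 ≤ x ∨ x ≤ 0 := by
  have hsplit : x = x⁺ + -x⁻ := by rw [← sub_eq_add_neg, posPart_sub_negPart]
  have hcross : 0 ≤ cartanForm A x⁺ (-x⁻) := by
    rw [cartanForm_eq_sum]
    refine Finset.sum_nonneg fun i _ => Finset.sum_nonneg fun j _ => ?_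
    have hp : x⁺ i = max (x i) 0 := rfl
    have hn : x⁻ j = max (-x j) 0 := rfl
    rw [Pi.neg_apply, hp, hn]
    by_cases hij : i = j
    · subst hij
      rcases le_total (x i) 0 with h | h <;> simp [h]
    · have h0 : A i j ≤ 0 := by rcases hA.offDiag i j hij with h | h <;> simp [h]
      exact mul_nonneg_of_nonpos_of_nonpos
        (mul_nonpos_of_nonneg_of_nonpos (le_max_right _ _) h0)
        (neg_nonpos.2 (le_max_right _ _))
  by_contra! hcon
  have h1 : x⁺ ≠ 0 := fun h => hcon.2 (posPart_eq_zero.1 h)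
  have h2 : -x⁻ ≠ 0 := fun h => hcon.1 (negPart_eq_zero.1 (neg_eq_zero.1 h))
  have h3 := hA.two_le_cartanForm_self h1
  have h4 := hA.two_le_cartanForm_self h2
  have h5 : cartanForm A x x = 2 := hx
  rw [hsplit, hA.cartanForm_add_self] at h5
  linarith

/-- A simple reflection permutes the positive roots other than its own simple root. -/
lemma simpleRefl_nonneg (hA : IsSimplyLacedCartan A)
    {x : I → ℤ} (hx : IsRoot A x) (h0 : 0 ≤ x) {i : I}
    (hne : x ≠ Pi.single i 1) : 0 ≤ simpleRefl A i x := by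
  refine (hA.nonneg_or_nonpos (hA.isRoot_simpleRefl hx i)).resolve_right fun hneg => hne ?_
  have hx' : x = x i • Pi.single i 1 := by
    funext j
    by_cases hj : j = i
    · subst hj; simp
    · have := hneg j
      rw [simpleRefl_apply_of_ne hj] at this
      simpa [hj] using le_antisymm this (h0 j)
  have h2 : cartanForm A x x = 2 := hx
  rw [hx', hA.cartanForm_smul_single_self] at h2
  have h1 : x i = 1 := by
    have : 0 ≤ x i := h0 i
    nlinarith
  rw [hx', h1, one_smul]

lemma simpleRefl_single_self (hA : IsSimplyLacedCartan A) (i : I) :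
    simpleRefl A i (Pi.single i 1) = -Pi.single i 1 := by
  rw [simpleRefl_apply, mulVec_single_apply, hA.diag, two_smul]; abel

lemma simpleRefl_mul_self (hA : IsSimplyLacedCartan A)
    (i : I) : simpleRefl A i * simpleRefl A i = 1 := by
  refine LinearMap.ext fun x => ?_
  rw [Module.End.mul_apply]
  nth_rw 2 [simpleRefl_apply]
  rw [map_sub, map_smul, hA.simpleRefl_single_self, simpleRefl_apply]
  simp

lemma wordEnd_reverse_mul (hA : IsSimplyLacedCartan A)
    (l : List I) : wordEnd A l.reverse * wordEnd A l = 1 := by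
  induction l with
  | nil => simp
  | cons i l ih =>
    rw [List.reverse_cons, wordEnd_append, wordEnd_cons, wordEnd_cons, wordEnd_nil, mul_one,
      mul_assoc, ← mul_assoc (simpleRefl A i), hA.simpleRefl_mul_self, one_mul, ih]

lemma wordEnd_mul_reverse (hA : IsSimplyLacedCartan A)
    (l : List I) : wordEnd A l * wordEnd A l.reverse = 1 := by
  simpa using hA.wordEnd_reverse_mul l.reverse

lemma wordEnd_reverse_congr (hA : IsSimplyLacedCartan A)
    {l m : List I} (h : wordEnd A l = wordEnd A m) :
    wordEnd A l.reverse = wordEnd A m.reverse := by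
  rw [← mul_one (wordEnd A l.reverse), ← hA.wordEnd_mul_reverse m, ← h, ← mul_assoc,
    hA.wordEnd_reverse_mul, one_mul]

lemma cartanForm_simpleRefl (hA : IsSimplyLacedCartan A) (i : I) (x y : I → ℤ) :
    cartanForm A (simpleRefl A i x) (simpleRefl A i y) = cartanForm A x y := by
  have h : ∀ x y : I → ℤ, cartanForm A (simpleRefl A i x) y
      = cartanForm A x y - (A *ᵥ x) i * (A *ᵥ y) i := by
    intro x y
    rw [simpleRefl_apply, sub_eq_add_neg, ← neg_smul, cartanForm_add, cartanForm_smul,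
      cartanForm_single]
    ring
  have h' : (A *ᵥ simpleRefl A i y) i = -(A *ᵥ y) i := by
    rw [simpleRefl_apply, mulVec_sub, mulVec_smul, Pi.sub_apply, Pi.smul_apply,
      mulVec_single_apply, hA.diag, smul_eq_mul]
    ring
  rw [h, h', hA.cartanForm_comm, h, hA.cartanForm_comm]
  ring

lemma cartanForm_wordEnd (hA : IsSimplyLacedCartan A) (l : List I) (x y : I → ℤ) :
    cartanForm A (wordEnd A l x) (wordEnd A l y) = cartanForm A x y := by
  induction l with
  | nil => rfl
  | cons i l ih => rw [wordEnd_cons, Module.End.mul_apply, Module.End.mul_apply,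
      hA.cartanForm_simpleRefl, ih]

/-- If `w` sends the simple root of `i` to that of `j`, then it conjugates `s_i` to `s_j`. -/
lemma wordEnd_mul_simpleRefl (hA : IsSimplyLacedCartan A) {l : List I} {i j : I}
    (h : wordEnd A l (Pi.single i 1) = Pi.single j 1) :
    wordEnd A l * simpleRefl A i = simpleRefl A j * wordEnd A l := by
  refine LinearMap.ext fun x => ?_
  rw [Module.End.mul_apply, Module.End.mul_apply, simpleRefl_apply, simpleRefl_apply,
    map_sub, map_smul, h, ← cartanForm_single, ← cartanForm_single, ← h, hA.cartanForm_wordEnd]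

/-- The exchange condition, on the right. -/
lemma exchange (hA : IsSimplyLacedCartan A) (l : List I) (i : I) :
    0 ≤ wordEnd A l (Pi.single i 1) ∨
      ∃ m : List I, m.length + 1 = l.length ∧ wordEnd A l = wordEnd A m * simpleRefl A i := by
  induction l with
  | nil => exact .inl (Pi.single_nonneg.2 zero_le_one)
  | cons j l ih =>
    rcases ih with h | ⟨m, hm, he⟩
    · by_cases hj : wordEnd A l (Pi.single i 1) = Pi.single j 1
      · exact .inr ⟨l, rfl, by rw [wordEnd_cons, hA.wordEnd_mul_simpleRefl hj]⟩
      · left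
        rw [wordEnd_cons, Module.End.mul_apply]
        exact hA.simpleRefl_nonneg (hA.isRoot_wordEnd (hA.isRoot_single i) l) h hj
    · exact .inr ⟨j :: m, by simp [hm], by rw [wordEnd_cons, wordEnd_cons, he, mul_assoc]⟩

lemma not_nonneg_of_nonpos (hA : IsSimplyLacedCartan A)
    {l : List I} {i : I} (h : wordEnd A l (Pi.single i 1) ≤ 0) :
    ¬ 0 ≤ wordEnd A l (Pi.single i 1) := by
  intro h'
  have h2 := hA.isRoot_wordEnd (hA.isRoot_single i) l
  rw [le_antisymm h h', IsRoot] at h2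
  simp [cartanForm] at h2

/-- The exchange condition, on the left. -/
lemma exists_cons (hA : IsSimplyLacedCartan A)
    {l : List I} {i : I} (h : wordEnd A l.reverse (Pi.single i 1) ≤ 0) :
    ∃ m : List I, (i :: m).length = l.length ∧ wordEnd A (i :: m) = wordEnd A l := by
  obtain ⟨m, hm, he⟩ := (hA.exchange l.reverse i).resolve_left (hA.not_nonneg_of_nonpos h)
  refine ⟨m.reverse, by simpa using hm, ?_⟩
  have := hA.wordEnd_reverse_congr (l := l.reverse) (m := m ++ [i]) (by simp [he])
  simpa using this.symm

end IsSimplyLacedCartan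

/-- A word is reduced if no shorter word represents the same element. -/
def IsReducedWord (A : Matrix I I ℤ) (l : List I) : Prop :=
  ∀ m : List I, wordEnd A m = wordEnd A l → l.length ≤ m.length

lemma IsReducedWord.congr {l m : List I} (h : IsReducedWord A l)
    (hlen : m.length = l.length) (he : wordEnd A m = wordEnd A l) : IsReducedWord A m :=
  fun k hk => hlen ▸ h k (hk.trans he)

lemma IsReducedWord.of_cons {i : I} {l : List I} (h : IsReducedWord A (i :: l)) :
    IsReducedWord A l := fun m hm => by
  simpa using h (i :: m) (by rw [wordEnd_cons, wordEnd_cons, hm])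

/-- Braid moves between words. -/
inductive BraidMove (A : Matrix I I ℤ) : List I → List I → Prop
  | comm (u v : List I) (i j : I) (h : A i j = 0) :
      BraidMove A (u ++ i :: j :: v) (u ++ j :: i :: v)
  | braid (u v : List I) (i j : I) (h : A i j = -1) :
      BraidMove A (u ++ i :: j :: i :: v) (u ++ j :: i :: j :: v)

lemma BraidMove.length_eq {l m : List I} (h : BraidMove A l m) : l.length = m.length := by
  cases h <;> simp

lemma BraidMove.cons {l m : List I} (h : BraidMove A l m) (i : I) :
    BraidMove A (i :: l) (i :: m) := by
  cases h with
  | comm u v j k h => exact .comm (i :: u) v j k h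
  | braid u v j k h => exact .braid (i :: u) v j k h

lemma eqvGen_braidMove_cons {l m : List I} (h : Relation.EqvGen (BraidMove A) l m) (i : I) :
    Relation.EqvGen (BraidMove A) (i :: l) (i :: m) := by
  induction h with
  | rel _ _ h => exact .rel _ _ (h.cons i)
  | refl _ => exact .refl _
  | symm _ _ _ ih => exact .symm _ _ ih
  | trans _ _ _ _ _ ih₁ ih₂ => exact .trans _ _ _ ih₁ ih₂

namespace IsSimplyLacedCartan

lemma simpleRefl_commute (hA : IsSimplyLacedCartan A) {i j : I} (h : A i j = 0) :
    simpleRefl A i * simpleRefl A j = simpleRefl A j * simpleRefl A i := by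
  simpa using hA.wordEnd_mul_simpleRefl (l := [i]) (i := j) (j := j)
    (by simp [simpleRefl_single, h])

lemma simpleRefl_braid (hA : IsSimplyLacedCartan A) {i j : I} (h : A i j = -1) :
    simpleRefl A i * (simpleRefl A j * simpleRefl A i)
      = simpleRefl A j * (simpleRefl A i * simpleRefl A j) := by
  have h' : A j i = -1 := hA.symm i j ▸ h
  have := hA.wordEnd_mul_simpleRefl (l := [i, j]) (i := i) (j := j) (by
    simp [simpleRefl_single, hA.diag, h, h', two_mul])
  simpa [mul_assoc] using this

lemma wordEnd_eq_of_braidMove (hA : IsSimplyLacedCartan A) {l m : List I} (h : BraidMove A l m) :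
    wordEnd A l = wordEnd A m := by
  cases h with
  | comm u v i j h =>
    simp only [wordEnd_append, wordEnd_cons, ← mul_assoc (simpleRefl A _) (simpleRefl A _),
      hA.simpleRefl_commute h]
  | braid u v i j h =>
    have := congrArg (fun w => wordEnd A u * (w * wordEnd A v)) (hA.simpleRefl_braid h)
    simpa [mul_assoc] using this

lemma reverse_single_nonpos (hA : IsSimplyLacedCartan A)
    {i : I} {l : List I} (h : IsReducedWord A (i :: l)) :
    wordEnd A (i :: l).reverse (Pi.single i 1) ≤ 0 := by
  rcases hA.nonneg_or_nonpos (hA.isRoot_wordEnd (hA.isRoot_single i) (i :: l).reverse)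
    with h0 | h0
  · exfalso
    have h1 : wordEnd A l.reverse (Pi.single i 1) ≤ 0 := by
      simpa [hA.simpleRefl_single_self] using h0
    obtain ⟨m, hm, he⟩ := hA.exists_cons h1
    have := h m (by
      rw [wordEnd_cons, ← he, wordEnd_cons, ← mul_assoc, hA.simpleRefl_mul_self, one_mul])
    simp at this hm
    omega
  · exact h0

lemma wordEnd_cons_inj (hA : IsSimplyLacedCartan A) {i : I} {l m : List I}
    (h : wordEnd A (i :: l) = wordEnd A (i :: m)) : wordEnd A l = wordEnd A m := by
  have := congrArg (simpleRefl A i * ·) h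
  simpa [← mul_assoc, hA.simpleRefl_mul_self] using this

lemma wordEnd_reverse_of_cons (hA : IsSimplyLacedCartan A) (i : I) (l : List I) :
    wordEnd A l.reverse = wordEnd A (i :: l).reverse * simpleRefl A i := by
  simp [mul_assoc, hA.simpleRefl_mul_self]

/-- Matsumoto's theorem: reduced words of the same element are connected by braid moves. -/
theorem matsumoto (hA : IsSimplyLacedCartan A)
    (n : ℕ) : ∀ l m : List I, l.length = n → m.length = n →
    IsReducedWord A l → wordEnd A l = wordEnd A m → Relation.EqvGen (BraidMove A) l m := by
  induction n using Nat.strong_induction_on with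
  | _ n ih =>
  have tail : ∀ (i : I) (l m : List I), (i :: l).length = n → (i :: m).length = n →
      IsReducedWord A (i :: l) → wordEnd A (i :: l) = wordEnd A (i :: m) →
      Relation.EqvGen (BraidMove A) (i :: l) (i :: m) := by
    intro i l m hl hm hr he
    simp only [List.length_cons] at hl hm
    exact eqvGen_braidMove_cons
      (ih l.length (by omega) l m rfl (by omega) hr.of_cons (hA.wordEnd_cons_inj he)) i
  intro l m hl hm hr he
  match l, m with
  | [], [] => exact .refl _
  | [], _ :: _ => simp at hl hm; omega
  | _ :: _, [] => simp at hl hm; omega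
  | i :: l, j :: m =>
  by_cases hij : i = j
  · subst hij; exact tail i l m hl hm hr he
  have hi := hA.reverse_single_nonpos hr
  have hj := hA.reverse_single_nonpos (hr.congr (hm.trans hl.symm) he.symm)
  rw [← hA.wordEnd_reverse_congr he] at hj
  rcases hA.offDiag i j hij with h | h
  · obtain ⟨u, hu, heu⟩ := hA.exists_cons (l := l) (i := j) (by
      rw [hA.wordEnd_reverse_of_cons i, Module.End.mul_apply, simpleRefl_single, h]
      simpa using hj)
    have hmv : BraidMove A (i :: j :: u) (j :: i :: u) := .comm [] u i j h
    have he₁ : wordEnd A (i :: l) = wordEnd A (i :: j :: u) := by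
      rw [wordEnd_cons, ← heu, wordEnd_cons i]
    have hlen : (i :: j :: u).length = (i :: l).length := by
      rw [List.length_cons, hu, List.length_cons]
    have he₂ := hA.wordEnd_eq_of_braidMove hmv
    refine .trans _ _ _ (tail i l (j :: u) hl (hlen.trans hl) hr he₁) ?_
    refine .trans _ _ _ (.rel _ _ hmv) ?_
    exact tail j _ m (hmv.length_eq.symm.trans (hlen.trans hl)) hm
      (hr.congr (hmv.length_eq.symm.trans hlen) (he₂.symm.trans he₁.symm))
      (he₂.symm.trans (he₁.symm.trans he))
  · have h' : A j i = -1 := hA.symm i j ▸ h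
    obtain ⟨u, hu, heu⟩ := hA.exists_cons (l := l) (i := j) (by
      rw [hA.wordEnd_reverse_of_cons i, Module.End.mul_apply, simpleRefl_single, h,
        neg_smul, one_smul, sub_neg_eq_add, map_add]
      exact add_nonpos hj hi)
    obtain ⟨v, hv, hev⟩ := hA.exists_cons (l := u) (i := i) (by
      rw [hA.wordEnd_reverse_of_cons j, Module.End.mul_apply, hA.wordEnd_reverse_congr heu,
        hA.wordEnd_reverse_of_cons i, Module.End.mul_apply, simpleRefl_single, h', neg_smul,
        one_smul, sub_neg_eq_add, map_add, hA.simpleRefl_single_self, simpleRefl_single, h,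
        neg_smul, one_smul, sub_neg_eq_add, neg_add_cancel_comm_assoc]
      exact hj)
    have hmv : BraidMove A (i :: j :: i :: v) (j :: i :: j :: v) := .braid [] v i j h
    have he₁ : wordEnd A (i :: l) = wordEnd A (i :: j :: i :: v) := by
      rw [wordEnd_cons, ← heu, wordEnd_cons j, ← hev, wordEnd_cons i (j :: _), wordEnd_cons j]
    have hlen : (i :: j :: i :: v).length = (i :: l).length := by
      simp only [List.length_cons] at hu hv ⊢; omega
    have he₂ := hA.wordEnd_eq_of_braidMove hmv
    refine .trans _ _ _ (tail i l _ hl (hlen.trans hl) hr he₁) ?_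
    refine .trans _ _ _ (.rel _ _ hmv) ?_
    exact tail j _ m (hmv.length_eq.symm.trans (hlen.trans hl)) hm
      (hr.congr (hmv.length_eq.symm.trans hlen) (he₂.symm.trans he₁.symm))
      (he₂.symm.trans (he₁.symm.trans he))

end IsSimplyLacedCartan

lemma mem_redWord_iff {w₀ : Function.End (I → ℤ)} {ν : ℕ} {f g : Fin ν → I}
    (hg : g ∈ RedWord A w₀ ν) :
    f ∈ RedWord A w₀ ν ↔ wordEnd A (List.ofFn f) = wordEnd A (List.ofFn g) := by
  rw [← prod_sE_eq_iff, show ((List.ofFn g).map (sE A)).prod = w₀ from hg]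
  rfl

lemma tAdjacent_of_braidMove {w₀ : Function.End (I → ℤ)} {ν : ℕ} (pv : I → ℕ)
    {f g : Fin ν → I} (hf : f ∈ RedWord A w₀ ν) (hg : g ∈ RedWord A w₀ ν)
    (h : BraidMove A (List.ofFn f) (List.ofFn g)) :
    TAdjacent A w₀ ν (f, fun k => (pv (f k) : ℤ)) (g, fun k => (pv (g k) : ℤ)) := by
  have get : ∀ (f : Fin ν → I) (l : List I), List.ofFn f = l → ∀ (k : ℕ) (hk : k < ν),
      some (f ⟨k, hk⟩) = l[k]? := by
    rintro f _ rfl k hk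
    simp [hk]
  refine ⟨hf, hg, ?_⟩
  generalize hl : List.ofFn f = l at h
  generalize hm : List.ofFn g = m at h
  have hν : l.length = ν := by simp [← hl]
  cases h with
  | comm u v i j h =>
    right
    simp only [List.length_append, List.length_cons] at hν
    have f0 : f ⟨u.length, by omega⟩ = i := by simpa using get f _ hl u.length (by omega)
    have f1 : f ⟨u.length + 1, by omega⟩ = j := by simpa using get f _ hl (u.length + 1) (by omega)
    have g0 : g ⟨u.length, by omega⟩ = j := by simpa using get g _ hm u.length (by omega)
    have g1 : g ⟨u.length + 1, by omega⟩ = i := by simpa using get g _ hm (u.length + 1) (by omega)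
    have rest : ∀ k : Fin ν, (k : ℕ) ≠ u.length → (k : ℕ) ≠ u.length + 1 → g k = f k := by
      intro k h0 h1
      apply Option.some_injective
      rw [get f _ hl k k.2, get g _ hm k k.2]
      rcases lt_or_ge (k : ℕ) u.length with hk | hk
      · rw [List.getElem?_append_left hk, List.getElem?_append_left hk]
      · obtain ⟨d, hd⟩ : ∃ d, (k : ℕ) = u.length + (d + 2) := ⟨k - u.length - 2, by omega⟩
        simp [hd, List.getElem?_append_right]
    refine ⟨u.length, by omega, by omega, ?_⟩
    simp only [f0, f1, g0, g1, h, true_and, and_self, and_true]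
    exact fun k h0 h1 => by simp [rest k h0 h1]
  | braid u v i j h =>
    left
    simp only [List.length_append, List.length_cons] at hν
    have f0 : f ⟨u.length, by omega⟩ = i := by simpa using get f _ hl u.length (by omega)
    have f1 : f ⟨u.length + 1, by omega⟩ = j := by simpa using get f _ hl (u.length + 1) (by omega)
    have f2 : f ⟨u.length + 2, by omega⟩ = i := by simpa using get f _ hl (u.length + 2) (by omega)
    have g0 : g ⟨u.length, by omega⟩ = j := by simpa using get g _ hm u.length (by omega)
    have g1 : g ⟨u.length + 1, by omega⟩ = i := by simpa using get g _ hm (u.length + 1) (by omega)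
    have g2 : g ⟨u.length + 2, by omega⟩ = j := by simpa using get g _ hm (u.length + 2) (by omega)
    have rest : ∀ k : Fin ν, (k : ℕ) ≠ u.length → (k : ℕ) ≠ u.length + 1 →
        (k : ℕ) ≠ u.length + 2 → g k = f k := by
      intro k h0 h1 h2
      apply Option.some_injective
      rw [get f _ hl k k.2, get g _ hm k k.2]
      rcases lt_or_ge (k : ℕ) u.length with hk | hk
      · rw [List.getElem?_append_left hk, List.getElem?_append_left hk]
      · obtain ⟨d, hd⟩ : ∃ d, (k : ℕ) = u.length + (d + 3) := ⟨k - u.length - 3, by omega⟩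
        simp [hd, List.getElem?_append_right]
    refine ⟨u.length, by omega, by omega, by omega, ?_⟩
    simp only [f0, f1, f2, g0, g1, g2, h, true_and, min_self, add_sub_cancel_right,
      add_sub_cancel_left, and_true]
    exact fun k h0 h1 h2 => by simp [rest k h0 h1 h2]

lemma eqvGen_tAdjacent (hA : IsSimplyLacedCartan A) {w₀ : Function.End (I → ℤ)} {ν : ℕ}
    (pv : I → ℕ) {l m : List I} (h : Relation.EqvGen (BraidMove A) l m) :
    ∀ f g : Fin ν → I, List.ofFn f = l → List.ofFn g = m → f ∈ RedWord A w₀ ν →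
      g ∈ RedWord A w₀ ν → Relation.EqvGen (TAdjacent A w₀ ν)
        (f, fun k => (pv (f k) : ℤ)) (g, fun k => (pv (g k) : ℤ)) := by
  have inv : ∀ {l m : List I}, Relation.EqvGen (BraidMove A) l m →
      l.length = m.length ∧ wordEnd A l = wordEnd A m := by
    intro l m h
    induction h with
    | rel _ _ h => exact ⟨h.length_eq, hA.wordEnd_eq_of_braidMove h⟩
    | refl _ => exact ⟨rfl, rfl⟩
    | symm _ _ _ ih => exact ⟨ih.1.symm, ih.2.symm⟩
    | trans _ _ _ _ _ ih₁ ih₂ => exact ⟨ih₁.1.trans ih₂.1, ih₁.2.trans ih₂.2⟩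
  induction h with
  | rel l m h =>
    rintro f g rfl rfl hf hg
    exact .rel _ _ (tAdjacent_of_braidMove pv hf hg h)
  | refl l =>
    rintro f g rfl hm _ _
    rw [List.ofFn_injective hm]
    exact .refl _
  | symm l m _ ih => exact fun f g hl hm hf hg => .symm _ _ (ih g f hm hl hg hf)
  | trans l k m h₁ _ ih₁ ih₂ =>
    rintro f g rfl rfl hf hg
    obtain ⟨hlen, he⟩ := inv h₁
    rw [List.length_ofFn] at hlen
    subst hlen
    have hk : List.ofFn k.get = k := List.ofFn_get k
    have hkr : k.get ∈ RedWord A w₀ k.length := (mem_redWord_iff hf).2 (by rw [hk, he])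
    exact .trans _ _ _ (ih₁ f k.get rfl hk hf hkr) (ih₂ k.get g hk rfl hkr hg)

end Matsumoto

/-- for `p ∈ ℕ^I`, all pairs `(i, (p_{i_1}, …, p_{i_ν}))` with
`i ∈ ℐ` are equivalent; hence `h_p ∈ 𝒰_ℕ` is well defined. -/
theorem h_p_well_defined (A : Matrix I I ℤ) (hA : IsSimplyLacedCartan A)
    (w₀ : Function.End (I → ℤ)) (ν : ℕ) (hw : IsLongest A w₀ ν)
    (pv : I → ℕ) (f g : Fin ν → I)
    (hf : f ∈ RedWord A w₀ ν) (hg : g ∈ RedWord A w₀ ν) :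
    Relation.EqvGen (TAdjacent A w₀ ν)
      (f, fun k => (pv (f k) : ℤ)) (g, fun k => (pv (g k) : ℤ)) := by
  refine eqvGen_tAdjacent hA pv (hA.matsumoto ν _ _ List.length_ofFn List.length_ofFn ?_
    ((mem_redWord_iff hg).1 hf)) f g rfl rfl hf hg
  intro m hm
  rw [List.length_ofFn, ← hw.len_eq]
  exact Nat.sInf_le ⟨m, rfl, ((prod_sE_eq_iff m _).2 hm).trans hf⟩

end Lusztig
end
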